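/- arXiv:2201.03461 — 2 statements merged into one kernel-verified Lean document; each statement's English description precedes it below -/
import Mathlib

section
/- Let L be a hitomezashi loop and let a be a longitude at which L has at least one horizontal stitch. Then: (i) any two consecutive stitches of L at longitude a differ in latitude by an odd integer; and (ii) the north-most and south-most horizontal stitches of L at longitude a differ in latitude by an odd integer. The analogous statements hold for the vertical stitches of L at a fixed latitude. -/
/-- A stitch is a unit segment of the grid: `vert i j` is the vertical segment from
`(i,j)` to `(i,j+1)`; `horiz i j` is the horizontal segment from `(i,j)` to `(i+1,j)`. -/
inductive Stitch : Type
  | vert : ℤ → ℤ → Stitch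
  | horiz : ℤ → ℤ → Stitch
  deriving DecidableEq

/-- Membership of a stitch in the hitomezashi pattern with labels `ε` (vertical lines)
and `η` (horizontal lines). -/
def Stitch.InPattern (ε η : ℤ → ZMod 2) : Stitch → Prop
  | .vert i j => (j : ZMod 2) = ε i
  | .horiz i j => (i : ZMod 2) = η j

/-- The stitch as a subset of the plane. -/
def Stitch.seg : Stitch → Set (ℝ × ℝ)
  | .vert i j => segment ℝ ((i : ℝ), (j : ℝ)) ((i : ℝ), (j : ℝ) + 1)
  | .horiz i j => segment ℝ ((i : ℝ), (j : ℝ)) ((i : ℝ) + 1, (j : ℝ))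

/-- The union of the segments of a set of stitches. -/
def curveOf (S : Set Stitch) : Set (ℝ × ℝ) := ⋃ s ∈ S, s.seg

/-- `C` is a simple closed curve: it is homeomorphic to a circle. -/
def IsCircle (C : Set (ℝ × ℝ)) : Prop :=
  Nonempty (C ≃ₜ Metric.sphere (0 : ℝ × ℝ) 1)

/-- The interior of a closed curve `C`: the union of the bounded connected
components of its complement. -/
def intOf (C : Set (ℝ × ℝ)) : Set (ℝ × ℝ) :=
  {p | p ∉ C ∧ Bornology.IsBounded (connectedComponentIn Cᶜ p)}

/-- The exterior of a closed curve `C`: the union of the unbounded connected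
components of its complement. -/
def extOf (C : Set (ℝ × ℝ)) : Set (ℝ × ℝ) :=
  {p | p ∉ C ∧ ¬ Bornology.IsBounded (connectedComponentIn Cᶜ p)}

/-- The open unit cell with southwest corner `(i,j)`. -/
def cell (i j : ℤ) : Set (ℝ × ℝ) :=
  Set.Ioo (i : ℝ) ((i : ℝ) + 1) ×ˢ Set.Ioo (j : ℝ) ((j : ℝ) + 1)

/-- A hitomezashi loop in the pattern with labels `ε`, `η`: a (finite) set of stitches
of the pattern whose union is a simple closed curve. -/
structure HLoop (ε η : ℤ → ZMod 2) where
  stitches : Finset Stitch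
  inPattern : ∀ s ∈ stitches, s.InPattern ε η
  isCircle : IsCircle (curveOf ↑stitches)

theorem sphere_isPreconnected_compl_singleton {E : Type*} [NormedAddCommGroup E] [NormedSpace ℝ E]
    (p : Metric.sphere (0 : E) 1) : IsPreconnected ({p}ᶜ : Set (Metric.sphere (0 : E) 1)) := by
  have hp : ‖(p : E)‖ = 1 := by simp
  have hp0 : (p : E) ≠ 0 := by intro h; simp [h] at hp
  let U : Set E := {v | ∀ r : ℝ, 0 ≤ r → v ≠ r • (p : E)}
  have hU0 : ∀ v ∈ U, v ≠ 0 := fun v hv h => hv 0 le_rfl (by simp [h])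
  have hstar : StarConvex ℝ (-(p : E)) U := by
    intro v hv a b ha hb hab r hr h
    rcases hb.eq_or_lt with rfl | hb'
    · have h2 : (a + r) • (p : E) = 0 := by
        rw [add_smul, ← h]; simp
      rcases smul_eq_zero.1 h2 with h3 | h3
      · linarith
      · exact hp0 h3
    · refine hv (b⁻¹ * (r + a)) (by positivity) ?_
      have h2 : b • v = (r + a) • (p : E) := by
        rw [add_smul, ← h]; simp
      rw [mul_smul, ← h2, smul_smul, inv_mul_cancel₀ hb'.ne', one_smul]
  have hneg : -(p : E) ∈ U := by
    intro r hr h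
    have h2 : (1 + r) • (p : E) = 0 := by
      rw [add_smul, ← h]; simp
    rcases smul_eq_zero.1 h2 with h3 | h3
    · linarith
    · exact hp0 h3
  have hUc : IsPreconnected U := (hstar.isPathConnected hneg).isConnected.isPreconnected
  have himg : (Subtype.val '' ({p}ᶜ : Set (Metric.sphere (0 : E) 1))) =
      (fun v : E => ‖v‖⁻¹ • v) '' U := by
    ext x
    constructor
    · rintro ⟨q, hq, rfl⟩
      have hqn : ‖(q : E)‖ = 1 := by simp
      refine ⟨q, ?_, by simp [hqn]⟩
      intro r hr h
      have h1 : r = 1 := by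
        have := congrArg norm h
        rw [norm_smul, hp, hqn, Real.norm_of_nonneg hr] at this
        linarith
      exact hq (Subtype.ext (by simpa [h1] using h))
    · rintro ⟨v, hv, rfl⟩
      have hv0 : ‖v‖ ≠ 0 := norm_ne_zero_iff.2 (hU0 v hv)
      refine ⟨⟨‖v‖⁻¹ • v, by simp [norm_smul, hv0]⟩, ?_, rfl⟩
      intro h
      have h1 : ‖v‖⁻¹ • v = (p : E) := congrArg Subtype.val h
      refine hv ‖v‖ (norm_nonneg v) ?_
      rw [← h1, smul_smul, mul_inv_cancel₀ hv0, one_smul]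
  rw [← Topology.IsInducing.subtypeVal.isPreconnected_image, himg]
  refine hUc.image _ ?_
  refine ContinuousOn.smul (ContinuousOn.inv₀ continuous_norm.continuousOn ?_) continuousOn_id
  exact fun v hv => norm_ne_zero_iff.2 (hU0 v hv)

namespace IsCircle

variable {C : Set (ℝ × ℝ)}

theorem isPreconnected (h : IsCircle C) : IsPreconnected C := by
  obtain ⟨e⟩ := h
  have hS : IsPreconnected (Metric.sphere (0 : ℝ × ℝ) 1) :=
    isPreconnected_sphere (by rw [← Module.finrank_eq_rank]; simp) 0 1
  have := isPreconnected_iff_preconnectedSpace.1 hS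
  have h1 := isPreconnected_range e.symm.continuous
  rw [e.symm.surjective.range_eq] at h1
  exact isPreconnected_iff_preconnectedSpace.2 ⟨h1⟩

theorem isPreconnected_diff_singleton (h : IsCircle C) {m : ℝ × ℝ} (hm : m ∈ C) :
    IsPreconnected (C \ {m}) := by
  obtain ⟨e⟩ := h
  have h1 := (sphere_isPreconnected_compl_singleton (e ⟨m, hm⟩)).image
    (fun x => (e.symm x : ℝ × ℝ)) (by fun_prop)
  convert h1 using 1
  ext x
  constructor
  · rintro ⟨hx, hxm⟩
    refine ⟨e ⟨x, hx⟩, ?_, by simp⟩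
    intro h2
    exact hxm (congrArg Subtype.val (e.injective h2))
  · rintro ⟨q, hq, rfl⟩
    refine ⟨(e.symm q).2, ?_⟩
    intro h2
    apply hq
    have h3 : e.symm q = ⟨m, hm⟩ := Subtype.ext h2
    rw [← h3]; simp

end IsCircle

theorem isClosed_segment (a b : ℝ × ℝ) : IsClosed (segment ℝ a b) := by
  rw [segment_eq_image_lineMap]
  exact (isCompact_Icc.image (by fun_prop)).isClosed

theorem segment_subset_union_midpoint (a b : ℝ × ℝ) :
    segment ℝ a b ⊆ segment ℝ a (midpoint ℝ a b) ∪ segment ℝ (midpoint ℝ a b) b := by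
  simp only [segment_eq_image_lineMap]
  rintro _ ⟨r, ⟨hr0, hr1⟩, rfl⟩
  rcases le_total r (1 / 2) with h | h
  · refine Or.inl ⟨2 * r, ⟨by linarith, by linarith⟩, ?_⟩
    simp only [AffineMap.lineMap_apply_module, midpoint_eq_smul_add, invOf_eq_inv]
    module
  · refine Or.inr ⟨2 * r - 1, ⟨by linarith, by linarith⟩, ?_⟩
    simp only [AffineMap.lineMap_apply_module, midpoint_eq_smul_add, invOf_eq_inv]
    module

theorem Stitch.mem_seg_vert {i j : ℤ} {p : ℝ × ℝ} :
    p ∈ (Stitch.vert i j).seg ↔ p.1 = i ∧ (j : ℝ) ≤ p.2 ∧ p.2 ≤ j + 1 := by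
  obtain ⟨x, y⟩ := p
  rw [Stitch.seg, ← Prod.image_mk_segment_right, segment_eq_Icc (by linarith)]
  simp only [Set.mem_image, Set.mem_Icc, Prod.mk.injEq]
  grind

theorem Stitch.mem_seg_horiz {i j : ℤ} {p : ℝ × ℝ} :
    p ∈ (Stitch.horiz i j).seg ↔ p.2 = j ∧ (i : ℝ) ≤ p.1 ∧ p.1 ≤ i + 1 := by
  obtain ⟨x, y⟩ := p
  rw [Stitch.seg, ← Prod.image_mk_segment_left, segment_eq_Icc (by linarith)]
  simp only [Set.mem_image, Set.mem_Icc, Prod.mk.injEq]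
  grind

theorem Stitch.isClosed_seg (s : Stitch) : IsClosed s.seg := by
  cases s <;> exact isClosed_segment _ _

theorem isClosed_curveOf (S : Finset Stitch) : IsClosed (curveOf ↑S) :=
  S.finite_toSet.isClosed_biUnion fun s _ => s.isClosed_seg

theorem mem_curveOf {S : Set Stitch} {p : ℝ × ℝ} : p ∈ curveOf S ↔ ∃ s ∈ S, p ∈ s.seg := by
  simp [curveOf]

/-- Two stitches of the same direction in a hitomezashi pattern which meet are equal. -/
theorem Stitch.vert_eq_of_mem {ε η : ℤ → ZMod 2} {i j i' j' : ℤ} {p : ℝ × ℝ}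
    (h : (Stitch.vert i j).InPattern ε η) (h' : (Stitch.vert i' j').InPattern ε η)
    (hp : p ∈ (Stitch.vert i j).seg) (hp' : p ∈ (Stitch.vert i' j').seg) : i = i' ∧ j = j' := by
  rw [Stitch.mem_seg_vert] at hp hp'
  simp only [Stitch.InPattern] at h h'
  have hi : i = i' := by exact_mod_cast hp.1.symm.trans hp'.1
  subst hi
  have h1 : j ≤ j' + 1 := by exact_mod_cast hp.2.1.trans hp'.2.2
  have h2 : j' ≤ j + 1 := by exact_mod_cast hp'.2.1.trans hp.2.2
  have h3 := (ZMod.intCast_eq_intCast_iff_dvd_sub _ _ _).1 (h.trans h'.symm)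
  exact ⟨rfl, by push_cast at h3; omega⟩

theorem Stitch.horiz_eq_of_mem {ε η : ℤ → ZMod 2} {i j i' j' : ℤ} {p : ℝ × ℝ}
    (h : (Stitch.horiz i j).InPattern ε η) (h' : (Stitch.horiz i' j').InPattern ε η)
    (hp : p ∈ (Stitch.horiz i j).seg) (hp' : p ∈ (Stitch.horiz i' j').seg) :
    i = i' ∧ j = j' := by
  rw [Stitch.mem_seg_horiz] at hp hp'
  simp only [Stitch.InPattern] at h h'
  have hj : j = j' := by exact_mod_cast hp.1.symm.trans hp'.1
  subst hj
  have h1 : i ≤ i' + 1 := by exact_mod_cast hp.2.1.trans hp'.2.2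
  have h2 : i' ≤ i + 1 := by exact_mod_cast hp'.2.1.trans hp.2.2
  have h3 := (ZMod.intCast_eq_intCast_iff_dvd_sub _ _ _).1 (h.trans h'.symm)
  exact ⟨by push_cast at h3; omega, rfl⟩

/-- A horizontal and a vertical stitch can only meet at a common endpoint. -/
theorem Stitch.horiz_inter_vert {i j i' j' : ℤ} {p : ℝ × ℝ}
    (hp : p ∈ (Stitch.horiz i j).seg) (hp' : p ∈ (Stitch.vert i' j').seg) :
    p = ((i' : ℝ), (j : ℝ)) ∧ (i' = i ∨ i' = i + 1) ∧ (j' = j ∨ j' = j - 1) := by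
  rw [Stitch.mem_seg_horiz] at hp
  rw [Stitch.mem_seg_vert] at hp'
  rw [hp'.1] at hp
  rw [hp.1] at hp'
  have h1 : i ≤ i' := by exact_mod_cast hp.2.1
  have h2 : i' ≤ i + 1 := by exact_mod_cast hp.2.2
  have h3 : j' ≤ j := by exact_mod_cast hp'.2.1
  have h4 : j ≤ j' + 1 := by exact_mod_cast hp'.2.2
  refine ⟨Prod.ext hp'.1 hp.1, ?_, ?_⟩ <;> omega

/-- A stitch of a simple closed curve cannot have an endpoint lying on no other stitch. -/
theorem IsCircle.not_free_end {S : Finset Stitch} (hC : IsCircle (curveOf ↑S)) {s : Stitch}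
    (hs : s ∈ S) {a b : ℝ × ℝ} (hseg : s.seg = segment ℝ a b) (hab : a ≠ b)
    (h : ∀ t ∈ S, t ≠ s → t.seg ∩ s.seg ⊆ {b}) : False := by
  set m := midpoint ℝ a b with hm
  have hms : m ∈ s.seg := by rw [hseg]; exact midpoint_mem_segment a b
  have hmC : m ∈ curveOf (S : Set Stitch) := mem_curveOf.2 ⟨s, hs, hms⟩
  have ham : a ≠ m := fun h => hab ((left_eq_midpoint_iff ℝ).1 h)
  have hbm : b ≠ m := fun h => hab ((right_eq_midpoint_iff ℝ).1 h)
  have hw : Wbtw ℝ a m b := wbtw_midpoint ℝ a b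
  have key := isPreconnected_closed_iff.1 (hC.isPreconnected_diff_singleton hmC)
    (segment ℝ a m) (segment ℝ m b ∪ curveOf ↑(S.erase s))
    (isClosed_segment _ _)
    ((isClosed_segment _ _).union (isClosed_curveOf _)) ?_ ?_ ?_
  · obtain ⟨x, ⟨hxC, hxm⟩, hx1, hx2⟩ := key
    have hx1' : Wbtw ℝ a x m := mem_segment_iff_wbtw.1 hx1
    rcases hx2 with hx2 | hx2
    · have hx2' : Wbtw ℝ m x b := mem_segment_iff_wbtw.1 hx2
      exact hxm ((hw.trans_left_right hx1').swap_left_iff.1 hx2')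
    · obtain ⟨t, ht, hxt⟩ := mem_curveOf.1 hx2
      have ht' : t ∈ S ∧ t ≠ s := by simpa using ht
      have hxs : x ∈ s.seg := by
        rw [hseg]; exact mem_segment_iff_wbtw.2 (hw.trans_left hx1')
      have hxb : x = b := h t ht'.1 ht'.2 ⟨hxt, hxs⟩
      rw [hxb] at hx1'
      exact hbm (hw.swap_right_iff.1 hx1').symm
  · rintro x ⟨hxC, -⟩
    obtain ⟨t, ht, hxt⟩ := mem_curveOf.1 hxC
    by_cases hts : t = s
    · subst hts
      rw [hseg] at hxt
      exact (segment_subset_union_midpoint a b hxt).imp_right Or.inl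
    · exact Or.inr (Or.inr (mem_curveOf.2 ⟨t, by simpa [hts] using ht, hxt⟩))
  · exact ⟨a, ⟨mem_curveOf.2 ⟨s, hs, hseg ▸ left_mem_segment ℝ a b⟩, ham⟩,
      left_mem_segment ℝ a m⟩
  · exact ⟨b, ⟨mem_curveOf.2 ⟨s, hs, hseg ▸ right_mem_segment ℝ a b⟩, hbm⟩,
      Or.inl (right_mem_segment ℝ m b)⟩

theorem Finset.exists_stitch_bound (S : Finset Stitch) : ∃ N : ℤ,
    (∀ i j, Stitch.horiz i j ∈ S → -N < i ∧ i < N ∧ -N < j ∧ j < N) ∧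
    (∀ i j, Stitch.vert i j ∈ S → -N < i ∧ i < N ∧ -N < j ∧ j < N) := by
  induction S using Finset.induction_on with
  | empty => exact ⟨0, by simp, by simp⟩
  | insert s S _ ih =>
    obtain ⟨N, h1, h2⟩ := ih
    obtain ⟨a, b, hs⟩ : ∃ a b, s = Stitch.horiz a b ∨ s = Stitch.vert a b := by
      cases s <;> simp
    refine ⟨max N (|a| + |b| + 1), fun i j h => ?_, fun i j h => ?_⟩ <;>
    · have := h1 i j
      have := h2 i j
      grind

namespace HLoop

variable {ε η : ℤ → ZMod 2} (L : HLoop ε η)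

theorem vert_mem_of_horiz_mem {i j x : ℤ} (hs : Stitch.horiz i j ∈ L.stitches)
    (hx : x = i ∨ x = i + 1) :
    Stitch.vert x j ∈ L.stitches ∨ Stitch.vert x (j - 1) ∈ L.stitches := by
  by_contra! hno
  have key : ∀ x' : ℤ, (∀ i', i' = i ∨ i' = i + 1 → i' = x ∨ i' = x') →
      ∀ t ∈ L.stitches, t ≠ Stitch.horiz i j →
      t.seg ∩ (Stitch.horiz i j).seg ⊆ {((x' : ℝ), (j : ℝ))} := by
    rintro x' hx' (⟨i', j'⟩ | ⟨i', j'⟩) ht hts p ⟨hp, hp'⟩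
    · obtain ⟨rfl, h1, h2⟩ := Stitch.horiz_inter_vert hp' hp
      rcases hx' i' h1 with rfl | rfl
      · rcases h2 with rfl | rfl
        · exact absurd ht hno.1
        · exact absurd ht hno.2
      · rfl
    · obtain ⟨rfl, rfl⟩ := Stitch.horiz_eq_of_mem (L.inPattern _ ht) (L.inPattern _ hs) hp hp'
      exact absurd rfl hts
  rcases hx with rfl | rfl
  · refine L.isCircle.not_free_end hs (a := ((x : ℝ), (j : ℝ)))
      (b := (((x + 1 : ℤ) : ℝ), (j : ℝ))) ?_ ?_ (key (x + 1) fun i' h => h)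
    · simp [Stitch.seg]
    · simp
  · refine L.isCircle.not_free_end hs (a := (((i + 1 : ℤ) : ℝ), (j : ℝ)))
      (b := ((i : ℝ), (j : ℝ))) ?_ ?_ (key i fun i' h => h.symm)
    · rw [segment_symm]; simp [Stitch.seg]
    · simp

theorem horiz_mem_of_vert_mem {i j y : ℤ} (hs : Stitch.vert i j ∈ L.stitches)
    (hy : y = j ∨ y = j + 1) :
    Stitch.horiz i y ∈ L.stitches ∨ Stitch.horiz (i - 1) y ∈ L.stitches := by
  by_contra! hno
  have key : ∀ y' : ℤ, (∀ j', j' = j ∨ j' = j + 1 → j' = y ∨ j' = y') →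
      ∀ t ∈ L.stitches, t ≠ Stitch.vert i j →
      t.seg ∩ (Stitch.vert i j).seg ⊆ {((i : ℝ), (y' : ℝ))} := by
    rintro y' hy' (⟨i', j'⟩ | ⟨i', j'⟩) ht hts p ⟨hp, hp'⟩
    · obtain ⟨rfl, rfl⟩ := Stitch.vert_eq_of_mem (L.inPattern _ ht) (L.inPattern _ hs) hp hp'
      exact absurd rfl hts
    · obtain ⟨rfl, h1, h2⟩ := Stitch.horiz_inter_vert hp hp'
      rcases hy' j' (by omega) with rfl | rfl
      · rcases h1 with h1 | h1
        · exact absurd (h1 ▸ ht) hno.1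
        · exact absurd (show Stitch.horiz (i - 1) j' ∈ L.stitches by
            rwa [h1, add_sub_cancel_right]) hno.2
      · rfl
  rcases hy with rfl | rfl
  · refine L.isCircle.not_free_end hs (a := ((i : ℝ), (y : ℝ)))
      (b := ((i : ℝ), ((y + 1 : ℤ) : ℝ))) ?_ ?_ (key (y + 1) fun i' h => h)
    · simp [Stitch.seg]
    · simp
  · refine L.isCircle.not_free_end hs (a := ((i : ℝ), ((j + 1 : ℤ) : ℝ)))
      (b := ((i : ℝ), (j : ℝ))) ?_ ?_ (key j fun i' h => h.symm)
    · rw [segment_symm]; simp [Stitch.seg]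
    · simp

theorem not_horiz_mem_and_pred (i j : ℤ) :
    ¬ (Stitch.horiz i j ∈ L.stitches ∧ Stitch.horiz (i - 1) j ∈ L.stitches) := by
  rintro ⟨h1, h2⟩
  have := Stitch.horiz_eq_of_mem (p := ((i : ℝ), (j : ℝ))) (L.inPattern _ h1) (L.inPattern _ h2)
    (by simp [Stitch.mem_seg_horiz]) (by simp [Stitch.mem_seg_horiz])
  omega

theorem not_vert_mem_and_pred (i j : ℤ) :
    ¬ (Stitch.vert i j ∈ L.stitches ∧ Stitch.vert i (j - 1) ∈ L.stitches) := by
  rintro ⟨h1, h2⟩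
  have := Stitch.vert_eq_of_mem (p := ((i : ℝ), (j : ℝ))) (L.inPattern _ h1) (L.inPattern _ h2)
    (by simp [Stitch.mem_seg_vert]) (by simp [Stitch.mem_seg_vert])
  omega

/-- A function on the stitches of a loop which agrees on any two stitches sharing an endpoint
is constant. -/
theorem eq_of_locally_constant {α : Type*} (F : Stitch → α)
    (hF : ∀ i j i' j', Stitch.horiz i j ∈ L.stitches → Stitch.vert i' j' ∈ L.stitches →
      (i' = i ∨ i' = i + 1) → (j' = j ∨ j' = j - 1) → F (.horiz i j) = F (.vert i' j'))
    {s t : Stitch} (hs : s ∈ L.stitches) (ht : t ∈ L.stitches) : F s = F t := by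
  classical
  by_contra hne
  have hmeet : ∀ u ∈ L.stitches, ∀ v ∈ L.stitches, ∀ p, p ∈ u.seg → p ∈ v.seg → F u = F v := by
    rintro (⟨i, j⟩ | ⟨i, j⟩) hu (⟨i', j'⟩ | ⟨i', j'⟩) hv p hp hp'
    · obtain ⟨rfl, rfl⟩ := Stitch.vert_eq_of_mem (L.inPattern _ hu) (L.inPattern _ hv) hp hp'
      rfl
    · obtain ⟨-, h1, h2⟩ := Stitch.horiz_inter_vert hp' hp
      exact (hF _ _ _ _ hv hu h1 h2).symm
    · obtain ⟨-, h1, h2⟩ := Stitch.horiz_inter_vert hp hp'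
      exact hF _ _ _ _ hu hv h1 h2
    · obtain ⟨rfl, rfl⟩ := Stitch.horiz_eq_of_mem (L.inPattern _ hu) (L.inPattern _ hv) hp hp'
      rfl
  have hpt : ∀ u : Stitch, u.seg.Nonempty := by
    rintro (⟨i, j⟩ | ⟨i, j⟩) <;> exact ⟨_, left_mem_segment ℝ _ _⟩
  obtain ⟨p, hp⟩ := hpt s
  obtain ⟨q, hq⟩ := hpt t
  obtain ⟨x, -, hx1, hx2⟩ := isPreconnected_closed_iff.1 L.isCircle.isPreconnected
    (curveOf ↑(L.stitches.filter (F · = F s))) (curveOf ↑(L.stitches.filter (F · ≠ F s)))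
    (isClosed_curveOf _) (isClosed_curveOf _)
    (by
      intro x hx
      obtain ⟨u, hu, hxu⟩ := mem_curveOf.1 hx
      by_cases h : F u = F s
      · exact Or.inl (mem_curveOf.2 ⟨u, by simpa [h] using hu, hxu⟩)
      · exact Or.inr (mem_curveOf.2 ⟨u, by simpa [h] using hu, hxu⟩))
    ⟨p, mem_curveOf.2 ⟨s, hs, hp⟩, mem_curveOf.2 ⟨s, by simpa using hs, hp⟩⟩
    ⟨q, mem_curveOf.2 ⟨t, ht, hq⟩, mem_curveOf.2 ⟨t, by simpa [ht] using Ne.symm hne, hq⟩⟩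
  obtain ⟨u, hu, hxu⟩ := mem_curveOf.1 hx1
  obtain ⟨v, hv, hxv⟩ := mem_curveOf.1 hx2
  simp only [Finset.coe_filter, Set.mem_ofPred_eq] at hu hv
  exact hv.2 ((hmeet u hu.1 v hv.1 x hxu hxv).symm.trans hu.2)

/-- The indicator of the horizontal stitches of a loop. -/
def horizInd (i j : ℤ) : ZMod 2 := if Stitch.horiz i j ∈ L.stitches then 1 else 0

/-- The indicator of the vertical stitches of a loop. -/
def vertInd (i j : ℤ) : ZMod 2 := if Stitch.vert i j ∈ L.stitches then 1 else 0

/-- Each grid point is an endpoint of an even number of stitches of a loop. -/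
theorem ind_add_ind (i j : ℤ) :
    L.horizInd i j + L.horizInd (i - 1) j = L.vertInd i j + L.vertInd i (j - 1) := by
  have h1 := L.not_horiz_mem_and_pred i j
  have h2 := L.not_vert_mem_and_pred i j
  have h3 : Stitch.horiz i j ∈ L.stitches ∨ Stitch.horiz (i - 1) j ∈ L.stitches ↔
      Stitch.vert i j ∈ L.stitches ∨ Stitch.vert i (j - 1) ∈ L.stitches := by
    constructor
    · rintro (h | h)
      · exact L.vert_mem_of_horiz_mem h (by omega)
      · exact L.vert_mem_of_horiz_mem h (by omega)
    · rintro (h | h)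
      · exact L.horiz_mem_of_vert_mem h (by omega)
      · exact L.horiz_mem_of_vert_mem h (by omega)
  unfold horizInd vertInd
  split_ifs <;> first | rfl | (exfalso; tauto)

/-- There is a two-colouring of the unit cells, vanishing far away, which changes exactly across
the stitches of the loop. -/
theorem exists_cell_colouring : ∃ (w : ℤ → ℤ → ZMod 2) (N : ℤ),
    (∀ i j, w i (j - 1) = w i j + L.horizInd i j) ∧
    (∀ i j, w (i - 1) j = w i j + L.vertInd i j) ∧
    (∀ i j, (i ≤ -N ∨ N ≤ i ∨ j ≤ -N ∨ N ≤ j) → w i j = 0) := by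
  obtain ⟨N, hN1, hN2⟩ := L.stitches.exists_stitch_bound
  have hH : ∀ i j, (i ≤ -N ∨ N ≤ i ∨ j ≤ -N ∨ N ≤ j) → L.horizInd i j = 0 := fun i j h =>
    if_neg fun hm => by have := hN1 i j hm; omega
  have hV : ∀ i j, (i ≤ -N ∨ N ≤ i ∨ j ≤ -N ∨ N ≤ j) → L.vertInd i j = 0 := fun i j h =>
    if_neg fun hm => by have := hN2 i j hm; omega
  let w : ℤ → ℤ → ZMod 2 := fun i j => ∑ k ∈ Finset.Ioc j N, L.horizInd i k
  have hw1 : ∀ i j, w i (j - 1) = w i j + L.horizInd i j := by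
    intro i j
    by_cases hj : j ≤ N
    · have : Finset.Ioc (j - 1) N = insert j (Finset.Ioc j N) := by
        ext k; simp only [Finset.mem_Ioc, Finset.mem_insert]; omega
      simp only [w]
      rw [this, Finset.sum_insert (by simp), add_comm]
    · rw [hH i j (by omega)]
      simp only [w]
      rw [Finset.Ioc_eq_empty (by omega), Finset.Ioc_eq_empty (by omega)]; simp
  have hwN : ∀ i j, N ≤ j → w i j = 0 := fun i j h => by
    simp only [w]; rw [Finset.Ioc_eq_empty (by omega)]; simp
  have hwi : ∀ i j, (i ≤ -N ∨ N ≤ i) → w i j = 0 := fun i j h =>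
    Finset.sum_eq_zero fun k _ => hH i k (by omega)
  have hw2 : ∀ i j, w (i - 1) j = w i j + L.vertInd i j := by
    intro i j
    rcases le_total N j with hj | hj
    · rw [hwN _ _ hj, hwN _ _ hj, hV _ _ (by omega), add_zero]
    · induction j, hj using Int.leInductionDown with
      | base => rw [hwN _ _ le_rfl, hwN _ _ le_rfl, hV _ _ (by omega), add_zero]
      | pred j hj ih =>
        have h2 : (2 : ZMod 2) = 0 := rfl
        rw [hw1, hw1, ih]
        linear_combination L.ind_add_ind i j - (L.horizInd i j - L.vertInd i j) * h2
  refine ⟨w, N, hw1, hw2, fun i j h => ?_⟩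
  rcases h with h | h | h | h
  · exact hwi _ _ (Or.inl h)
  · exact hwi _ _ (Or.inr h)
  · rcases le_total N i with hi | hi
    · exact hwi _ _ (Or.inr hi)
    · induction i, hi using Int.leInductionDown with
      | base => exact hwi _ _ (Or.inr le_rfl)
      | pred i hi ih => rw [hw2, ih, hV _ _ (by omega), add_zero]
  · exact hwN _ _ h

/-- The colour of the cell to the left of a stitch is constant along a loop oriented so that the
horizontal stitches leave the points `(x, y)` with `x - y` even. -/
theorem left_colour_eq {w : ℤ → ℤ → ZMod 2}
    (hw1 : ∀ i j, w i (j - 1) = w i j + L.horizInd i j)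
    (hw2 : ∀ i j, w (i - 1) j = w i j + L.vertInd i j) : ∃ c : ZMod 2,
    (∀ i j, Stitch.horiz i j ∈ L.stitches → w i j + i + j = c) ∧
    (∀ i j, Stitch.vert i j ∈ L.stitches → w i j + i + j = c) := by
  let F : Stitch → ZMod 2 := fun s => match s with
    | .vert i j => w i j + i + j
    | .horiz i j => w i j + i + j
  have h2 : (2 : ZMod 2) = 0 := rfl
  have hF : ∀ s ∈ L.stitches, ∀ t ∈ L.stitches, F s = F t := by
    refine fun s hs t ht => L.eq_of_locally_constant F ?_ hs ht
    intro i j i' j' h h' hi hj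
    have e1 : L.horizInd i j = 1 := if_pos h
    have e2 : L.vertInd i' j' = 1 := if_pos h'
    simp only [F]
    rcases hi with rfl | rfl <;> rcases hj with rfl | rfl
    · rfl
    · rw [hw1, e1]; push_cast; ring
    · have := hw2 (i + 1) j'
      rw [add_sub_cancel_right, e2] at this
      rw [this]; push_cast; ring
    · have e3 : L.horizInd (i + 1) j = 0 := if_neg fun h3 =>
        L.not_horiz_mem_and_pred (i + 1) j ⟨h3, by rwa [add_sub_cancel_right]⟩
      have e4 : L.vertInd (i + 1) j = 0 := if_neg fun h3 =>
        L.not_vert_mem_and_pred (i + 1) j ⟨h3, h'⟩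
      have := hw2 (i + 1) j
      rw [add_sub_cancel_right, e4] at this
      rw [this, hw1, e3]; push_cast; ring
  rcases L.stitches.eq_empty_or_nonempty with h | ⟨s, hs⟩
  · exact ⟨0, by simp [h], by simp [h]⟩
  · exact ⟨F s, fun i j h => hF _ h _ hs, fun i j h => hF _ h _ hs⟩

end HLoop

section CrossSection

variable {u : ℤ → ZMod 2} {P : ℤ → Prop} [DecidablePred P]

theorem eq_of_no_crossing (hu : ∀ j, u (j - 1) = u j + if P j then 1 else 0) {a b : ℤ}
    (hab : a ≤ b) (h : ∀ j, a < j → j ≤ b → ¬ P j) : u a = u b := by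
  induction a, hab using Int.leInductionDown with
  | base => rfl
  | pred a ha ih =>
    rw [hu, ih fun j h1 h2 => h j (by omega) h2, if_neg (h a (by omega) ha), add_zero]

theorem odd_sub_of_colour_add_one {c : ZMod 2} {j1 j2 : ℤ} (h1 : u j1 + j1 = c)
    (h2 : u j2 + j2 = c) (h : u j1 = u j2 + 1) : Odd (j2 - j1) := by
  rw [← ZMod.intCast_eq_one_iff_odd]
  push_cast
  linear_combination h2 - h1 + h

theorem odd_sub_of_consecutive (hu : ∀ j, u (j - 1) = u j + if P j then 1 else 0) {c : ZMod 2}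
    (hc : ∀ j, P j → u j + j = c) {j1 j2 : ℤ} (h1 : P j1) (h2 : P j2) (hlt : j1 < j2)
    (h : ∀ j, P j → ¬ (j1 < j ∧ j < j2)) : Odd (j2 - j1) := by
  refine odd_sub_of_colour_add_one (hc _ h1) (hc _ h2) ?_
  rw [eq_of_no_crossing hu (show j1 ≤ j2 - 1 by omega)
    fun j h3 h4 h5 => h j h5 ⟨h3, by omega⟩, hu, if_pos h2]

theorem odd_sub_of_extreme (hu : ∀ j, u (j - 1) = u j + if P j then 1 else 0) {c : ZMod 2}
    (hc : ∀ j, P j → u j + j = c) {N : ℤ} (hN : ∀ j, (j ≤ -N ∨ N ≤ j) → u j = 0) {j1 j2 : ℤ}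
    (h1 : P j1) (h2 : P j2) (h : ∀ j, P j → j1 ≤ j ∧ j ≤ j2) : Odd (j2 - j1) := by
  refine odd_sub_of_colour_add_one (hc _ h1) (hc _ h2) ?_
  have e2 : u j2 = 0 := by
    rw [eq_of_no_crossing hu (le_max_left j2 N) fun j h3 _ h5 => by have := h j h5; omega]
    exact hN _ (Or.inr (le_max_right _ _))
  have e1 : u (j1 - 1) = 0 := by
    rw [← eq_of_no_crossing hu (min_le_left (j1 - 1) (-N))
      fun j _ h4 h5 => by have := h j h5; omega]
    exact hN _ (Or.inl (min_le_right _ _))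
  rw [hu, if_pos h1] at e1
  rw [e2, zero_add]
  have h2 : (2 : ZMod 2) = 0 := rfl
  linear_combination e1 - h2

end CrossSection

/-- Cross-sections of a hitomezashi loop: at any longitude `i + 1/2`
(the horizontal stitches there are the `horiz i j ∈ L`), any two consecutive stitches of
`L` differ in latitude by an odd integer, and the north-most and south-most stitches of
`L` there differ in latitude by an odd integer; analogously for vertical stitches at a
fixed latitude `j + 1/2`. -/
theorem hitomezashi_odd_cross_sections (ε η : ℤ → ZMod 2) (L : HLoop ε η) :
    (∀ i j1 j2 : ℤ, Stitch.horiz i j1 ∈ L.stitches → Stitch.horiz i j2 ∈ L.stitches →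
      j1 < j2 → (∀ j' : ℤ, Stitch.horiz i j' ∈ L.stitches → ¬ (j1 < j' ∧ j' < j2)) →
      Odd (j2 - j1)) ∧
    (∀ i j1 j2 : ℤ, Stitch.horiz i j1 ∈ L.stitches → Stitch.horiz i j2 ∈ L.stitches →
      (∀ j' : ℤ, Stitch.horiz i j' ∈ L.stitches → j1 ≤ j' ∧ j' ≤ j2) →
      Odd (j2 - j1)) ∧
    (∀ j i1 i2 : ℤ, Stitch.vert i1 j ∈ L.stitches → Stitch.vert i2 j ∈ L.stitches →
      i1 < i2 → (∀ i' : ℤ, Stitch.vert i' j ∈ L.stitches → ¬ (i1 < i' ∧ i' < i2)) →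
      Odd (i2 - i1)) ∧
    (∀ j i1 i2 : ℤ, Stitch.vert i1 j ∈ L.stitches → Stitch.vert i2 j ∈ L.stitches →
      (∀ i' : ℤ, Stitch.vert i' j ∈ L.stitches → i1 ≤ i' ∧ i' ≤ i2) →
      Odd (i2 - i1)) := by
  obtain ⟨w, N, hw1, hw2, hN⟩ := L.exists_cell_colouring
  obtain ⟨c, hc1, hc2⟩ := L.left_colour_eq hw1 hw2
  have hcol : ∀ i j, Stitch.horiz i j ∈ L.stitches → w i j + (j : ZMod 2) = c - i :=
    fun i j h => by linear_combination hc1 i j h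
  have hrow : ∀ j i, Stitch.vert i j ∈ L.stitches → w i j + (i : ZMod 2) = c - j :=
    fun j i h => by linear_combination hc2 i j h
  refine ⟨fun i j1 j2 h1 h2 hlt h => ?_, fun i j1 j2 h1 h2 h => ?_,
    fun j i1 i2 h1 h2 hlt h => ?_, fun j i1 i2 h1 h2 h => ?_⟩
  · exact odd_sub_of_consecutive (u := w i) (hw1 i) (hcol i) h1 h2 hlt h
  · exact odd_sub_of_extreme (u := w i) (hw1 i) (hcol i) (N := N)
      (fun j hj => hN i j (by tauto)) h1 h2 h
  · exact odd_sub_of_consecutive (u := (w · j)) (hw2 · j) (hrow j) h1 h2 hlt h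
  · exact odd_sub_of_extreme (u := (w · j)) (hw2 · j) (hrow j) (N := N)
      (fun i hi => hN i j (by tauto)) h1 h2 h
end

section
/- Let L be a hitomezashi loop. Then L has a north-extremal horizontal stitch with longitude a if and only if it has a south-extremal horizontal stitch with longitude a. Similarly, L has an east-extremal vertical stitch with latitude b if and only if it has a west-extremal vertical stitch with latitude b. -/
namespace Hitomezashi

/-- The sign `(-1) ^ n`. -/
def paritySign (n : ℤ) : ℤ := if Even n then 1 else -1

lemma paritySign_mul_self (n : ℤ) : paritySign n * paritySign n = 1 := by
  unfold paritySign; split_ifs <;> rfl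

lemma paritySign_add_one (n : ℤ) : paritySign (n + 1) = -paritySign n := by
  unfold paritySign; split_ifs <;> grind

lemma paritySign_sub_one (n : ℤ) : paritySign (n - 1) = -paritySign n := by
  unfold paritySign; split_ifs <;> grind

lemma paritySign_eq_or (n : ℤ) : paritySign n = 1 ∨ paritySign n = -1 := by
  unfold paritySign; split_ifs <;> simp

lemma not_cast_sub_one_eq {n : ℤ} {a : ZMod 2} (h : (n : ZMod 2) = a) :
    ((n - 1 : ℤ) : ZMod 2) ≠ a := by
  subst h
  simp

lemma exists_potential (d : ℤ → ℤ) : ∃ F : ℤ → ℤ, ∀ i, F i - F (i - 1) = d i := by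
  refine ⟨fun i => ∑ m ∈ Finset.Ioc 0 i, d m - ∑ m ∈ Finset.Ioc i 0, d m, fun i => ?_⟩
  dsimp only
  rcases le_or_gt i 0 with h | h
  · have h1 : Finset.Ioc (i - 1) 0 = insert i (Finset.Ioc i 0) := by
      ext m; simp only [Finset.mem_Ioc, Finset.mem_insert]; omega
    rw [h1, Finset.sum_insert (by simp), Finset.Ioc_eq_empty (by omega : ¬ 0 < i),
      Finset.Ioc_eq_empty (by omega : ¬ 0 < i - 1)]
    simp
  · have h1 : Finset.Ioc 0 i = insert i (Finset.Ioc 0 (i - 1)) := by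
      ext m; simp only [Finset.mem_Ioc, Finset.mem_insert]; omega
    rw [h1, Finset.sum_insert (by simp), Finset.Ioc_eq_empty (by omega : ¬ i < 0),
      Finset.Ioc_eq_empty (by omega : ¬ i - 1 < 0)]
    simp

/-- The combinatorial content of a hitomezashi loop with horizontal stitches `H` and vertical
stitches `V`: it is finite, it turns at each of its vertices, and it is connected. -/
structure LoopData (ε η : ℤ → ZMod 2) (H V : ℤ → ℤ → Prop) : Prop where
  horiz : ∀ {i j}, H i j → (i : ZMod 2) = η j
  vert : ∀ {i j}, V i j → (j : ZMod 2) = ε i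
  turn : ∀ i j, (H i j ∨ H (i - 1) j) ↔ (V i j ∨ V i (j - 1))
  conn : ∀ P : ℤ → ℤ → Prop, (∀ i j, H i j → (P i j ↔ P (i + 1) j)) →
    (∀ i j, V i j → (P i j ↔ P i (j + 1))) → ∀ i j i' j', (H i j ∨ H (i - 1) j) →
    (H i' j' ∨ H (i' - 1) j') → P i j → P i' j'
  finite_horiz : {p : ℤ × ℤ | H p.1 p.2}.Finite
  finite_vert : {p : ℤ × ℤ | V p.1 p.2}.Finite

namespace LoopData

variable {ε η : ℤ → ZMod 2} {H V : ℤ → ℤ → Prop}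

lemma swap (h : LoopData ε η H V) :
    LoopData η ε (fun a b => V b a) (fun a b => H b a) where
  horiz := h.vert
  vert := h.horiz
  turn i j := (h.turn j i).symm
  conn P hP hQ i j i' j' hij hij' := by
    rw [← h.turn] at hij hij'
    exact h.conn (fun a b => P b a) (fun _ _ => hQ _ _) (fun _ _ => hP _ _) j i j' i' hij hij'
  finite_horiz := h.finite_vert.preimage (f := Prod.swap) Prod.swap_injective.injOn
  finite_vert := h.finite_horiz.preimage (f := Prod.swap) Prod.swap_injective.injOn

lemma exists_vert_of_between (h : LoopData ε η H V) {i j i' j' m : ℤ} (h₁ : H i j)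
    (h₂ : H i' j') (hm : m < j) (hm' : j' ≤ m) : ∃ a, V a m := by
  by_contra! hV
  refine absurd (h.conn (fun _ b => m < b) (fun _ _ _ => Iff.rfl) (fun a b hab => ?_) i j i' j'
    (.inl h₁) (.inl h₂) hm) (by omega)
  have : b ≠ m := fun e => hV a (e ▸ hab)
  omega

lemma exists_horiz_of_between (h : LoopData ε η H V) {i j i' j' m : ℤ} (h₁ : V i j)
    (h₂ : V i' j') (hm : m < i) (hm' : i' ≤ m) : ∃ b, H m b :=
  h.swap.exists_vert_of_between h₁ h₂ hm hm'

/-- A strip between consecutive vertical lines that is crossed eastward is also crossed westward,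
and conversely. -/
lemma exists_horiz_opposite (h : LoopData ε η H V) {i j : ℤ} (hij : H i j) :
    ∃ j', H i j' ∧ paritySign (i + j') = -paritySign (i + j) := by
  classical
  have hfin : {p : ℤ × ℤ | (H p.1 p.2 ∨ H (p.1 - 1) p.2) ∧ p.1 ≤ i}.Finite := by
    have hinj : Function.Injective fun p : ℤ × ℤ => (p.1 - 1, p.2) := by
      rintro ⟨a, b⟩ ⟨c, d⟩ hp
      simpa using hp
    exact (h.finite_horiz.union (h.finite_horiz.preimage hinj.injOn)).subset fun p hp => hp.1
  set T := hfin.toFinset with hT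
  have memT : ∀ a b, (a, b) ∈ T ↔ (H a b ∨ H (a - 1) b) ∧ a ≤ i := fun a b => by simp [hT]
  have hH : ∀ {a b}, H a b → ¬ H (a - 1) b := fun h₁ h₂ =>
    not_cast_sub_one_eq (h.horiz h₁) (h.horiz h₂)
  have hV : ∀ {a b}, V a b → ¬ V a (b - 1) := fun h₁ h₂ =>
    not_cast_sub_one_eq (h.vert h₁) (h.vert h₂)
  have sumT : ∑ p ∈ T, paritySign (p.1 + p.2) = 0 := by
    refine Finset.sum_involution
      (fun p _ => if V p.1 p.2 then (p.1, p.2 + 1) else (p.1, p.2 - 1)) ?_ ?_ ?_ ?_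
    · rintro ⟨a, b⟩ -
      dsimp only
      split_ifs
      · rw [← add_assoc, paritySign_add_one]; ring
      · rw [← add_sub_assoc, paritySign_sub_one]; ring
    · rintro ⟨a, b⟩ - -
      dsimp only
      split_ifs <;> simp
    · rintro ⟨a, b⟩ hp
      rw [memT, h.turn] at hp
      dsimp only
      split_ifs with hv <;> rw [memT, h.turn]
      · simp [hv, hp.2]
      · exact ⟨.inl (hp.1.resolve_left hv), hp.2⟩
    · rintro ⟨a, b⟩ hp
      rw [memT, h.turn] at hp
      by_cases hv : V a b
      · have : ¬ V a (b + 1) := fun h' => hV h' (by simpa using hv)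
        simp [hv, this]
      · simp [hv, hp.1.resolve_left hv]
  have sumH : ∑ p ∈ T with ¬ (p.1 = i ∧ H p.1 p.2), paritySign (p.1 + p.2) = 0 := by
    refine Finset.sum_involution
      (fun p _ => if H p.1 p.2 then (p.1 + 1, p.2) else (p.1 - 1, p.2)) ?_ ?_ ?_ ?_
    · rintro ⟨a, b⟩ -
      dsimp only
      split_ifs
      · rw [add_right_comm, paritySign_add_one]; ring
      · rw [sub_add_eq_add_sub, paritySign_sub_one]; ring
    · rintro ⟨a, b⟩ - -
      dsimp only
      split_ifs <;> simp
    · rintro ⟨a, b⟩ hp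
      rw [Finset.mem_filter, memT] at hp
      dsimp only at hp ⊢
      obtain ⟨⟨h1, h2⟩, h3⟩ := hp
      split_ifs with hv <;> rw [Finset.mem_filter, memT]
      · have : ¬ H (a + 1) b := fun h' => hH h' (by simpa using hv)
        have : a ≠ i := fun e => h3 ⟨e, hv⟩
        refine ⟨⟨by simp [hv], by omega⟩, by tauto⟩
      · refine ⟨⟨.inl (h1.resolve_left hv), by omega⟩, fun h' => ?_⟩
        have := h'.1
        dsimp only at this
        omega
    · rintro ⟨a, b⟩ hp
      rw [Finset.mem_filter, memT] at hp
      by_cases hv : H a b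
      · have : ¬ H (a + 1) b := fun h' => hH h' (by simpa using hv)
        simp [hv, this]
      · simp [hv, hp.1.1.resolve_left hv]
  have sumC : ∑ p ∈ T with (p.1 = i ∧ H p.1 p.2), paritySign (p.1 + p.2) = 0 := by
    have := Finset.sum_filter_add_sum_filter_not T (fun p => p.1 = i ∧ H p.1 p.2)
      (fun p => paritySign (p.1 + p.2))
    omega
  by_contra! hne
  have hconst : ∀ p ∈ T.filter (fun p => p.1 = i ∧ H p.1 p.2),
      paritySign (p.1 + p.2) = paritySign (i + j) := by
    rintro ⟨a, b⟩ hp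
    obtain ⟨-, hab, hb⟩ := Finset.mem_filter.1 hp
    obtain rfl : a = i := hab
    replace hb : H a b := hb
    have := hne b hb
    have := paritySign_eq_or (a + b)
    have := paritySign_eq_or (a + j)
    change paritySign (a + b) = paritySign (a + j)
    omega
  rw [Finset.sum_congr rfl hconst, Finset.sum_const, smul_eq_zero] at sumC
  rcases sumC with h0 | h0
  · rw [Finset.card_eq_zero] at h0
    exact Finset.notMem_empty (i, j) (h0 ▸ by simp [memT, hij])
  · have := paritySign_eq_or (i + j)
    omega

lemma exists_vert_opposite (h : LoopData ε η H V) {i j : ℤ} (hij : V i j) :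
    ∃ i', V i' j ∧ paritySign (i' + j) = -paritySign (i + j) := by
  simpa only [add_comm] using h.swap.exists_horiz_opposite hij

/-- The loop is a level curve of the function `F i + G j` on unit cells. -/
lemma exists_height (h : LoopData ε η H V) {i₀ j₀ : ℤ} (h₀ : H i₀ j₀) {s : ℤ}
    (hs : s * s = 1) : ∃ F G : ℤ → ℤ, ∃ k : ℤ,
    (∀ i j, H i j → G j - G (j - 1) = s * paritySign (i + j) ∧
      2 * F i + G j + G (j - 1) = 2 * k - 1) ∧
    (∀ i j, V i j → F i - F (i - 1) = s * paritySign (i + j) ∧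
      F i + F (i - 1) + 2 * G j = 2 * k - 1) := by
  obtain ⟨F, hF⟩ := exists_potential fun i => s * if (i : ZMod 2) = ε i then 1 else -1
  obtain ⟨G, hG⟩ := exists_potential fun j => s * if (j : ZMod 2) = η j then 1 else -1
  have key : ∀ a b : ℤ, (if (a : ZMod 2) = b then 1 else -1) = paritySign (a + b) := fun a b => by
    have : (a : ZMod 2) = b ↔ Even (a + b) := by
      rw [ZMod.intCast_eq_intCast_iff_dvd_sub, Int.even_iff]
      push_cast
      omega
    simp [paritySign, this]
  have dG : ∀ i j, H i j → G j - G (j - 1) = s * paritySign (i + j) := fun i j hij => by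
    rw [hG, ← h.horiz hij, key, add_comm]
  have dF : ∀ i j, V i j → F i - F (i - 1) = s * paritySign (i + j) := fun i j hij => by
    rw [hF, ← h.vert hij, key]
  have sq : ∀ n, s * paritySign n * (s * paritySign n) = 1 := fun n => by
    linear_combination hs * paritySign n * paritySign n + paritySign_mul_self n
  let σ : ℤ → ℤ → ℤ := fun i j => F i + F (i - 1) + G j + G (j - 1) +
    s * paritySign (i + j) * (F i - F (i - 1)) * (G j - G (j - 1))
  have σH : ∀ i j, H i j → σ i j = 2 * F i + G j + G (j - 1) ∧
      σ (i + 1) j = 2 * F i + G j + G (j - 1) := fun i j hij => by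
    have e := dG i j hij
    simp only [σ, e, add_right_comm i 1 j, paritySign_add_one, add_sub_cancel_right]
    constructor
    · linear_combination (F i - F (i - 1)) * sq (i + j)
    · linear_combination (F i - F (i + 1)) * sq (i + j)
  have σV : ∀ i j, V i j → σ i j = F i + F (i - 1) + 2 * G j ∧
      σ i (j + 1) = F i + F (i - 1) + 2 * G j := fun i j hij => by
    have e := dF i j hij
    simp only [σ, e, ← add_assoc i j 1, paritySign_add_one, add_sub_cancel_right]
    constructor
    · linear_combination (G j - G (j - 1)) * sq (i + j)
    · linear_combination (G j - G (j + 1)) * sq (i + j)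
  have const : ∀ i j, (H i j ∨ H (i - 1) j) → σ i j = σ i₀ j₀ := fun i j hij =>
    h.conn (fun i j => σ i j = σ i₀ j₀) (fun i j hij => by rw [(σH i j hij).1, (σH i j hij).2])
      (fun i j hij => by rw [(σV i j hij).1, (σV i j hij).2]) i₀ j₀ i j (.inl h₀) hij rfl
  obtain ⟨k, hk⟩ : ∃ k, σ i₀ j₀ = 2 * k - 1 := by
    have h1 := (σH _ _ h₀).1
    have h2 : G j₀ - G (j₀ - 1) = 1 ∨ G j₀ - G (j₀ - 1) = -1 := by
      rw [dG _ _ h₀]; exact mul_self_eq_one_iff.1 (sq _)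
    rcases h2 with h2 | h2
    · exact ⟨F i₀ + G j₀, by omega⟩
    · exact ⟨F i₀ + G j₀ + 1, by omega⟩
  refine ⟨F, G, k, fun i j hij => ⟨dG i j hij, ?_⟩, fun i j hij => ⟨dF i j hij, ?_⟩⟩
  · rw [← hk, ← const i j (.inl hij), (σH i j hij).1]
  · rw [← hk, ← const i j ((h.turn i j).2 (.inl hij)), (σV i j hij).1]

lemma horiz_top_iff_bottom (h : LoopData ε η H V) {a b J K : ℤ} (hJ : H a J) (hK : H b K)
    (hJmax : ∀ i j, H i j → j ≤ J) (hKmin : ∀ i j, H i j → K ≤ j) (x : ℤ) :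
    H x J ↔ H x K := by
  have hs : -paritySign (a + J) * -paritySign (a + J) = 1 := by
    rw [neg_mul_neg, paritySign_mul_self]
  obtain ⟨F, G, k, hH, hV⟩ := h.exists_height hJ hs
  have hJW : G J - G (J - 1) = -1 := by
    rw [(hH a J hJ).1, neg_mul, paritySign_mul_self]
  have signs : ∀ n n', paritySign n' = -paritySign n →
      -paritySign (a + J) * paritySign n = 1 ∧ -paritySign (a + J) * paritySign n' = -1 ∨
      -paritySign (a + J) * paritySign n = -1 ∧ -paritySign (a + J) * paritySign n' = 1 :=
      fun n n' e => by
    rw [e]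
    rcases paritySign_eq_or (a + J) with h1 | h1 <;> rcases paritySign_eq_or n with h2 | h2 <;>
      simp [h1, h2]
  have east_west : ∀ i j, H i j → (∃ j', H i j' ∧ F i + G j' = k ∧ F i + G (j' - 1) = k - 1) ∧
      ∃ j', H i j' ∧ F i + G j' = k - 1 ∧ F i + G (j' - 1) = k := fun i j hij => by
    obtain ⟨j', hj', e⟩ := h.exists_horiz_opposite hij
    have h1 := hH i j hij
    have h2 := hH i j' hj'
    rcases signs _ _ e with ⟨e1, e2⟩ | ⟨e1, e2⟩ <;> rw [e1] at h1 <;> rw [e2] at h2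
    · exact ⟨⟨j, hij, by omega, by omega⟩, ⟨j', hj', by omega, by omega⟩⟩
    · exact ⟨⟨j', hj', by omega, by omega⟩, ⟨j, hij, by omega, by omega⟩⟩
  have south_north : ∀ i j, V i j →
      (∃ i', V i' j ∧ F i' + G j = k ∧ F (i' - 1) + G j = k - 1) ∧
      ∃ i', V i' j ∧ F i' + G j = k - 1 ∧ F (i' - 1) + G j = k := fun i j hij => by
    obtain ⟨i', hi', e⟩ := h.exists_vert_opposite hij
    have h1 := hV i j hij
    have h2 := hV i' j hi'
    rcases signs _ _ e with ⟨e1, e2⟩ | ⟨e1, e2⟩ <;> rw [e1] at h1 <;> rw [e2] at h2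
    · exact ⟨⟨i, hij, by omega, by omega⟩, ⟨i', hi', by omega, by omega⟩⟩
    · exact ⟨⟨i', hi', by omega, by omega⟩, ⟨i, hij, by omega, by omega⟩⟩
  -- every strip of columns contains a cell of height `k` inside the bounding box
  have see : ∀ i j, H i j → ∃ i' j', V i' j' ∧ F i + G j' = k := fun i j hij => by
    obtain ⟨j', hj', e1, e2⟩ := (east_west i j hij).1
    have hne : j' ≠ J := by rintro rfl; omega
    obtain ⟨i', hi'⟩ := h.exists_vert_of_between hJ hj'
      (lt_of_le_of_ne (hJmax i j' hj') hne) le_rfl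
    exact ⟨i', j', hi', e1⟩
  obtain ⟨⟨xM, uM⟩, hxM, hmax⟩ :=
    Set.exists_max_image _ (fun p : ℤ × ℤ => F p.1) h.finite_horiz ⟨(a, J), hJ⟩
  obtain ⟨⟨xm, um⟩, hxm, hmin⟩ :=
    Set.exists_min_image _ (fun p : ℤ × ℤ => F p.1) h.finite_horiz ⟨(a, J), hJ⟩
  have hmax' : ∀ i j, H i j → F i ≤ F xM := fun i j hij => hmax (i, j) hij
  have hmin' : ∀ i j, H i j → F xm ≤ F i := fun i j hij => hmin (i, j) hij
  change H xM uM at hxM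
  change H xm um at hxm
  have hsum : ∀ i j, V i j → k ≤ F xM + G j := by
    obtain ⟨i₁, j₁, hv₁, -⟩ := see _ _ hxM
    obtain ⟨⟨vm, ym⟩, hym, hGmin⟩ :=
      Set.exists_min_image _ (fun p : ℤ × ℤ => G p.2) h.finite_vert ⟨(i₁, j₁), hv₁⟩
    change V vm ym at hym
    intro i j hij
    have hGj : G ym ≤ G j := hGmin (i, j) hij
    by_contra! hlt
    obtain ⟨n, hn, e1, e2⟩ := (south_north vm ym hym).2
    have hnmin : ∀ i' j', V i' j' → n ≤ i' := fun i' j' hv => by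
      by_contra! hlt'
      obtain ⟨c, hc⟩ := h.exists_horiz_of_between (m := n - 1) hn hv (by omega) (by omega)
      have := hmax' _ _ hc
      omega
    obtain ⟨i₂, j₂, hv₂, e3⟩ := see _ _ hxm
    obtain ⟨i₃, hv₃, e4, e5⟩ := (south_north i₂ j₂ hv₂).1
    have hne : n ≠ i₃ := by rintro rfl; omega
    obtain ⟨c, hc⟩ := h.exists_horiz_of_between (m := i₃ - 1) hv₃ hn (by omega)
      (by have := hnmin _ _ hv₃; omega)
    have := hmin' _ _ hc
    omega
  have full : ∀ i j, H i j → F i = F xM → H i J ∧ H i K ∧ G K - G (K - 1) = 1 := by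
    intro i j hij hi
    obtain ⟨⟨p, hp, e1, e2⟩, q, hq, e3, e4⟩ := east_west i j hij
    have hpK : p = K := by
      by_contra hne
      obtain ⟨c, hc⟩ := h.exists_vert_of_between (m := p - 1) hp hK (by omega)
        (by have := hKmin _ _ hp; omega)
      have := hsum _ _ hc
      omega
    have hqJ : q = J := by
      by_contra hne
      obtain ⟨c, hc⟩ := h.exists_vert_of_between (m := q) hJ hq
        (by have := hJmax _ _ hq; omega) le_rfl
      have := hsum _ _ hc
      omega
    subst hpK hqJ
    exact ⟨hq, hp, by omega⟩
  obtain ⟨hMJ, hMK, hKE⟩ := full xM uM hxM rfl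
  have h1 := (hH _ _ hMJ).2
  have h2 := (hH _ _ hMK).2
  constructor
  · intro hx
    have := (hH _ _ hx).2
    exact (full x J hx (by omega)).2.1
  · intro hx
    have := (hH _ _ hx).2
    exact (full x K hx (by omega)).1

lemma north_iff_south (h : LoopData ε η H V) (i : ℤ) :
    (∃ j, H i j ∧ ∀ i' j', H i' j' → j' ≤ j) ↔ (∃ j, H i j ∧ ∀ i' j', H i' j' → j ≤ j') := by
  constructor
  · rintro ⟨j, hj, hmax⟩
    obtain ⟨⟨b, K⟩, hK, hmin⟩ :=
      Set.exists_min_image _ (fun p : ℤ × ℤ => p.2) h.finite_horiz ⟨(i, j), hj⟩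
    have hmin' : ∀ i j, H i j → K ≤ j := fun i j hij => hmin (i, j) hij
    exact ⟨K, (h.horiz_top_iff_bottom hj hK hmax hmin' i).1 hj, hmin'⟩
  · rintro ⟨j, hj, hmin⟩
    obtain ⟨⟨b, J⟩, hJ, hmax⟩ :=
      Set.exists_max_image _ (fun p : ℤ × ℤ => p.2) h.finite_horiz ⟨(i, j), hj⟩
    have hmax' : ∀ i j, H i j → j ≤ J := fun i j hij => hmax (i, j) hij
    exact ⟨J, (h.horiz_top_iff_bottom hJ hj hmax' hmin i).2 hj, hmax'⟩

end LoopData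

/-! ### Circles -/

/-- The radial parametrization of the unit sphere of the sup norm by angle. -/
noncomputable def squareParam (t : ℝ) : ℝ × ℝ :=
  ‖(Real.cos t, Real.sin t)‖⁻¹ • (Real.cos t, Real.sin t)

lemma norm_cos_sin_pos (t : ℝ) : 0 < ‖(Real.cos t, Real.sin t)‖ := by
  rw [norm_pos_iff]
  intro h
  have h1 := congrArg Prod.fst h
  have h2 := congrArg Prod.snd h
  have := Real.cos_sq_add_sin_sq t
  simp_all

lemma continuous_squareParam : Continuous squareParam := by
  unfold squareParam
  refine Continuous.smul (Continuous.inv₀ (by fun_prop) fun t => (norm_cos_sin_pos t).ne') ?_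
  fun_prop

lemma squareParam_mem_sphere (t : ℝ) : squareParam t ∈ Metric.sphere (0 : ℝ × ℝ) 1 := by
  rw [mem_sphere_zero_iff_norm, squareParam, norm_smul, norm_inv, norm_norm,
    inv_mul_cancel₀ (norm_cos_sin_pos t).ne']

lemma squareParam_periodic : Function.Periodic squareParam (2 * Real.pi) := fun t => by
  simp [squareParam]

lemma exists_squareParam_eq {q : ℝ × ℝ} (hq : q ∈ Metric.sphere (0 : ℝ × ℝ) 1) :
    ∃ t, squareParam t = q := by
  rw [mem_sphere_zero_iff_norm] at hq
  have hz : (⟨q.1, q.2⟩ : ℂ) ≠ 0 := by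
    intro h
    have h1 := congrArg Complex.re h
    have h2 := congrArg Complex.im h
    have : q = 0 := Prod.ext h1 h2
    simp [this] at hq
  have hz' : 0 < ‖(⟨q.1, q.2⟩ : ℂ)‖ := norm_pos_iff.2 hz
  refine ⟨Complex.arg ⟨q.1, q.2⟩, ?_⟩
  have : (Real.cos (Complex.arg ⟨q.1, q.2⟩), Real.sin (Complex.arg ⟨q.1, q.2⟩)) =
      ‖(⟨q.1, q.2⟩ : ℂ)‖⁻¹ • q := by
    ext
    · simp [Complex.cos_arg hz, div_eq_inv_mul]
    · simp [Complex.sin_arg, div_eq_inv_mul]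
  rw [squareParam, this, norm_smul, hq, norm_inv, norm_norm, mul_one, inv_inv, smul_smul,
    mul_inv_cancel₀ hz'.ne', one_smul]

lemma squareParam_eq_imp {t u : ℝ} (h : squareParam t = squareParam u) :
    (t : Real.Angle) = u := by
  unfold squareParam at h
  have ht := inv_pos.2 (norm_cos_sin_pos t)
  have hu := inv_pos.2 (norm_cos_sin_pos u)
  set a := ‖(Real.cos t, Real.sin t)‖⁻¹
  set b := ‖(Real.cos u, Real.sin u)‖⁻¹
  have h1 : a * Real.cos t = b * Real.cos u := congrArg Prod.fst h
  have h2 : a * Real.sin t = b * Real.sin u := congrArg Prod.snd h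
  have h3 : a ^ 2 = b ^ 2 := by
    linear_combination (a * Real.cos t + b * Real.cos u) * h1 +
      (a * Real.sin t + b * Real.sin u) * h2 - a ^ 2 * Real.cos_sq_add_sin_sq t +
      b ^ 2 * Real.cos_sq_add_sin_sq u
  have hab : a = b := (sq_eq_sq₀ ht.le hu.le).1 h3
  rw [hab] at h1 h2
  exact Real.Angle.cos_sin_inj (mul_left_cancel₀ hu.ne' h1) (mul_left_cancel₀ hu.ne' h2)

lemma isPreconnected_sphere_diff_singleton {p : ℝ × ℝ} (hp : p ∈ Metric.sphere (0 : ℝ × ℝ) 1) :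
    IsPreconnected (Metric.sphere (0 : ℝ × ℝ) 1 \ {p}) := by
  obtain ⟨θ, rfl⟩ := exists_squareParam_eq hp
  have : Metric.sphere (0 : ℝ × ℝ) 1 \ {squareParam θ} =
      squareParam '' Set.Ioo θ (θ + 2 * Real.pi) := by
    ext q
    constructor
    · rintro ⟨hq, hne⟩
      obtain ⟨t, rfl⟩ := exists_squareParam_eq hq
      obtain ⟨u, hu, e⟩ := squareParam_periodic.exists_mem_Ico Real.two_pi_pos t θ
      refine ⟨u, ⟨lt_of_le_of_ne hu.1 ?_, hu.2⟩, e.symm⟩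
      rintro rfl
      exact hne e
    · rintro ⟨t, ⟨ht, ht'⟩, rfl⟩
      refine ⟨squareParam_mem_sphere t, fun h => ?_⟩
      obtain ⟨n, hn⟩ := Real.Angle.angle_eq_iff_two_pi_dvd_sub.1 (squareParam_eq_imp h)
      have hpi := Real.two_pi_pos
      have h0 : (0 : ℝ) < n := by
        by_contra! h'
        nlinarith
      have h1 : (n : ℝ) < 1 := by
        by_contra! h'
        nlinarith
      norm_cast at h0 h1
      omega
  rw [this]
  exact isPreconnected_Ioo.image _ continuous_squareParam.continuousOn

lemma isPreconnected_sphere_plane : IsPreconnected (Metric.sphere (0 : ℝ × ℝ) 1) := by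
  have : Metric.sphere (0 : ℝ × ℝ) 1 = squareParam '' Set.univ := by
    ext q
    rw [Set.image_univ]
    exact ⟨exists_squareParam_eq, fun ⟨t, ht⟩ => ht ▸ squareParam_mem_sphere t⟩
  rw [this]
  exact isPreconnected_univ.image _ continuous_squareParam.continuousOn

end Hitomezashi

open Hitomezashi

lemma IsCircle.isPreconnected_s11 {C : Set (ℝ × ℝ)} (hC : IsCircle C) : IsPreconnected C := by
  obtain ⟨e⟩ := hC
  have := isPreconnected_iff_preconnectedSpace.1 isPreconnected_sphere_plane
  exact isPreconnected_iff_preconnectedSpace.2 (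
    e.symm.surjective.denseRange.preconnectedSpace e.symm.continuous)

lemma IsCircle.isPreconnected_diff_singleton_s11 {C : Set (ℝ × ℝ)} (hC : IsCircle C) {p : ℝ × ℝ}
    (hp : p ∈ C) : IsPreconnected (C \ {p}) := by
  obtain ⟨e⟩ := hC
  have h := isPreconnected_sphere_diff_singleton (e ⟨p, hp⟩).2
  have h1 : Metric.sphere (0 : ℝ × ℝ) 1 \ {(e ⟨p, hp⟩ : ℝ × ℝ)} =
      Subtype.val '' (e '' {⟨p, hp⟩}ᶜ) := by
    rw [Set.image_compl_eq e.bijective, Set.image_singleton]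
    ext q
    simp
  have h2 : C \ {p} = Subtype.val '' ({⟨p, hp⟩}ᶜ : Set C) := by
    ext q
    simp
  rw [h1, Topology.IsInducing.subtypeVal.isPreconnected_image,
    e.isInducing.isPreconnected_image] at h
  rw [h2]
  exact h.image _ continuous_subtype_val.continuousOn

namespace Hitomezashi

/-! ### Stitches as plane segments -/

/-- The inclusion of the integer lattice into the plane. -/
def toPlane (c : ℤ × ℤ) : ℝ × ℝ := (c.1, c.2)

/-- The lattice point `c` is an endpoint of the stitch `s`. -/
def IsEnd (c : ℤ × ℤ) : Stitch → Prop
  | .vert i j => c = (i, j) ∨ c = (i, j + 1)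
  | .horiz i j => c = (i, j) ∨ c = (i + 1, j)

lemma toPlane_injective : Function.Injective toPlane := fun c d h => by
  simpa [toPlane, Prod.ext_iff] using h

lemma mem_seg_vert {i j : ℤ} {q : ℝ × ℝ} :
    q ∈ (Stitch.vert i j).seg ↔ q.1 = i ∧ j ≤ q.2 ∧ q.2 ≤ j + 1 := by
  obtain ⟨x, y⟩ := q
  rw [Stitch.seg, ← Prod.image_mk_segment_right, segment_eq_Icc (by linarith)]
  simp [eq_comm, and_comm]

lemma mem_seg_horiz {i j : ℤ} {q : ℝ × ℝ} :
    q ∈ (Stitch.horiz i j).seg ↔ q.2 = j ∧ i ≤ q.1 ∧ q.1 ≤ i + 1 := by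
  obtain ⟨x, y⟩ := q
  rw [Stitch.seg, ← Prod.image_mk_segment_left, segment_eq_Icc (by linarith)]
  simp [eq_comm, and_comm]

lemma seg_eq_segment {c : ℤ × ℤ} {s : Stitch} (h : IsEnd c s) :
    ∃ d, c ≠ d ∧ s.seg = segment ℝ (toPlane c) (toPlane d) ∧
      ∀ c', IsEnd c' s → c' = c ∨ c' = d := by
  rcases s with ⟨i, j⟩ | ⟨i, j⟩ <;> rcases h with rfl | rfl
  · exact ⟨(i, j + 1), by simp, by simp [Stitch.seg, toPlane], fun _ h => h⟩
  · exact ⟨(i, j), by simp, by rw [segment_symm]; simp [Stitch.seg, toPlane], fun _ h => h.symm⟩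
  · exact ⟨(i + 1, j), by simp, by simp [Stitch.seg, toPlane], fun _ h => h⟩
  · exact ⟨(i, j), by simp, by rw [segment_symm]; simp [Stitch.seg, toPlane], fun _ h => h.symm⟩

/-- Distinct stitches meet only at common endpoints. -/
lemma exists_isEnd_of_mem_seg {s t : Stitch} (hst : s ≠ t) {q : ℝ × ℝ} (hs : q ∈ s.seg)
    (ht : q ∈ t.seg) : ∃ c, IsEnd c s ∧ IsEnd c t ∧ q = toPlane c := by
  have collinear : ∀ {j j' : ℤ} {y : ℝ}, j ≠ j' → j ≤ y → y ≤ j + 1 → j' ≤ y → y ≤ j' + 1 →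
      ∃ c : ℤ, (c = j ∨ c = j + 1) ∧ (c = j' ∨ c = j' + 1) ∧ y = c := by
    intro j j' y hne h1 h2 h3 h4
    have h5 : j ≤ j' + 1 := by exact_mod_cast h1.trans h4
    have h6 : j' ≤ j + 1 := by exact_mod_cast h3.trans h2
    rcases lt_or_gt_of_ne hne with h | h
    · obtain rfl : j' = j + 1 := by omega
      push_cast at h3
      exact ⟨j + 1, by simp, by simp, by push_cast; linarith⟩
    · obtain rfl : j = j' + 1 := by omega
      push_cast at h1
      exact ⟨j' + 1, by simp, by simp, by push_cast; linarith⟩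
  have cross : ∀ {j j' : ℤ}, (j : ℝ) ≤ j' → (j' : ℝ) ≤ j + 1 → j' = j ∨ j' = j + 1 := by
    intro j j' h1 h2
    norm_cast at h1 h2
    omega
  obtain ⟨x, y⟩ := q
  rcases s with ⟨i, j⟩ | ⟨i, j⟩ <;> rcases t with ⟨i', j'⟩ | ⟨i', j'⟩ <;>
    simp only [mem_seg_vert, mem_seg_horiz] at hs ht <;> obtain ⟨h1, h2, h3⟩ := hs <;>
    obtain ⟨h4, h5, h6⟩ := ht
  · obtain rfl : i = i' := by exact_mod_cast h1.symm.trans h4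
    obtain ⟨c, hc, hc', rfl⟩ := collinear (by grind) h2 h3 h5 h6
    exact ⟨(i, c), by simpa [IsEnd] using hc, by simpa [IsEnd] using hc', by simp [toPlane, h1]⟩
  · subst h1 h4
    exact ⟨(i, j'), by simpa [IsEnd] using cross h2 h3, by simpa [IsEnd] using cross h5 h6, rfl⟩
  · subst h1 h4
    exact ⟨(i', j), by simpa [IsEnd] using cross h2 h3, by simpa [IsEnd] using cross h5 h6, rfl⟩
  · obtain rfl : j = j' := by exact_mod_cast h1.symm.trans h4
    obtain ⟨c, hc, hc', rfl⟩ := collinear (by grind) h2 h3 h5 h6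
    exact ⟨(c, j), by simpa [IsEnd] using hc, by simpa [IsEnd] using hc', by simp [toPlane, h1]⟩

lemma exists_isEnd (s : Stitch) : ∃ c, IsEnd c s := by
  rcases s with ⟨i, j⟩ | ⟨i, j⟩ <;> exact ⟨(i, j), .inl rfl⟩

lemma toPlane_mem_seg {c : ℤ × ℤ} {s : Stitch} (h : IsEnd c s) : toPlane c ∈ s.seg := by
  obtain ⟨d, -, e, -⟩ := seg_eq_segment h
  exact e ▸ left_mem_segment ℝ _ _

lemma isClosed_segment_plane (x y : ℝ × ℝ) : IsClosed (segment ℝ x y) := by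
  rw [segment_eq_image_lineMap]
  exact (isCompact_Icc.image (by fun_prop)).isClosed

lemma isClosed_curveOf {S : Set Stitch} (hS : S.Finite) : IsClosed (curveOf S) := by
  refine hS.isClosed_biUnion fun s _ => ?_
  obtain ⟨c, hc⟩ := exists_isEnd s
  obtain ⟨d, -, e, -⟩ := seg_eq_segment hc
  exact e ▸ isClosed_segment_plane _ _

lemma mem_curveOf {S : Set Stitch} {q : ℝ × ℝ} : q ∈ curveOf S ↔ ∃ s ∈ S, q ∈ s.seg := by
  simp [curveOf]

lemma segment_subset_union_midpoint {E : Type*} [AddCommGroup E] [Module ℝ E] (v w : E) :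
    segment ℝ v w ⊆ segment ℝ v (midpoint ℝ v w) ∪ segment ℝ (midpoint ℝ v w) w := by
  rintro q ⟨a, b, ha, hb, hab, rfl⟩
  obtain rfl : a = 1 - b := by linarith
  rw [midpoint_eq_smul_add, invOf_eq_inv]
  rcases le_total b 2⁻¹ with h | h
  · exact .inl ⟨1 - 2 * b, 2 * b, by linarith, by linarith, by ring, by module⟩
  · exact .inr ⟨2 * (1 - b), 2 * b - 1, by linarith, by linarith, by ring, by module⟩

variable {ε η : ℤ → ZMod 2}

/-- A simple closed curve has no loose ends. -/
lemma exists_other_stitch (L : HLoop ε η) {s : Stitch} (hs : s ∈ L.stitches) {c : ℤ × ℤ}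
    (hc : IsEnd c s) : ∃ t ∈ L.stitches, t ≠ s ∧ IsEnd c t := by
  obtain ⟨d, hcd, hseg, hends⟩ := seg_eq_segment hc
  set v := toPlane c
  set w := toPlane d
  set m := midpoint ℝ v w with hm
  have hvw : 0 < dist v w := dist_pos.2 (toPlane_injective.ne hcd)
  have hvm : dist v m = 2⁻¹ * dist v w := by simp [hm, dist_left_midpoint]
  have hmw : dist m w = 2⁻¹ * dist v w := by simp [hm, dist_midpoint_right]
  have sub : ∀ {q}, q ∈ s.seg → q ∈ curveOf (L.stitches : Set Stitch) := fun hq =>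
    mem_curveOf.2 ⟨s, hs, hq⟩
  have hmC : m ∈ curveOf (L.stitches : Set Stitch) :=
    sub (hseg ▸ midpoint_mem_segment v w)
  have hpre := isPreconnected_closed_iff.1 (L.isCircle.isPreconnected_diff_singleton_s11 hmC)
    (segment ℝ v m) (segment ℝ m w ∪ curveOf (L.stitches \ {s} : Set Stitch))
    (isClosed_segment_plane _ _)
    ((isClosed_segment_plane _ _).union (isClosed_curveOf (L.stitches.finite_toSet.sdiff)))
    (fun q hq => by
      obtain ⟨t, ht, hqt⟩ := mem_curveOf.1 hq.1
      by_cases hts : t = s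
      · subst hts
        rcases segment_subset_union_midpoint v w (hseg ▸ hqt) with h | h
        · exact .inl h
        · exact .inr (.inl h)
      · exact .inr (.inr (mem_curveOf.2 ⟨t, ⟨ht, hts⟩, hqt⟩)))
    ⟨v, ⟨sub (hseg ▸ left_mem_segment ℝ v w), fun h => by
      rw [← Set.mem_singleton_iff.1 h, dist_self] at hvm; linarith⟩, left_mem_segment ℝ _ _⟩
    ⟨w, ⟨sub (hseg ▸ right_mem_segment ℝ v w), fun h => by
      rw [← Set.mem_singleton_iff.1 h, dist_self] at hmw; linarith⟩,
      .inl (right_mem_segment ℝ _ _)⟩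
  obtain ⟨q, ⟨-, hqm⟩, hq1, hq2⟩ := hpre
  have h1 := dist_add_dist_of_mem_segment hq1
  rcases hq2 with hq2 | hq2
  · have h2 := dist_add_dist_of_mem_segment hq2
    have h3 := dist_triangle v q w
    have h4 : 0 < dist q m := dist_pos.2 hqm
    rw [dist_comm m q] at h2
    linarith
  · obtain ⟨t, ⟨ht, hts⟩, hqt⟩ := mem_curveOf.1 hq2
    have hqs : q ∈ s.seg := by
      rw [hseg]
      exact (convex_segment v w).segment_subset (left_mem_segment ℝ _ _)
        (midpoint_mem_segment v w) hq1
    obtain ⟨c', hc's, hc't, rfl⟩ := exists_isEnd_of_mem_seg hts hqt hqs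
    rcases hends c' hc't with rfl | rfl
    · exact ⟨t, ht, hts, hc's⟩
    · have := dist_nonneg (x := w) (y := m)
      linarith

/-- The graph of stitches of a simple closed curve is connected. -/
lemma forall_end_of_exists (L : HLoop ε η) (P : ℤ × ℤ → Prop)
    (hP : ∀ s ∈ L.stitches, ∀ c d, IsEnd c s → IsEnd d s → P c → P d) {s t : Stitch}
    (hs : s ∈ L.stitches) (ht : t ∈ L.stitches) {c d : ℤ × ℤ} (hc : IsEnd c s) (hd : IsEnd d t)
    (h : P c) : P d := by
  by_contra hd'
  let S : Set Stitch := {r | r ∈ L.stitches ∧ ∀ c, IsEnd c r → P c}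
  let T : Set Stitch := {r | r ∈ L.stitches ∧ ∀ c, IsEnd c r → ¬ P c}
  have hpre := isPreconnected_closed_iff.1 L.isCircle.isPreconnected_s11 (curveOf S) (curveOf T)
    (isClosed_curveOf (L.stitches.finite_toSet.subset fun _ hr => hr.1))
    (isClosed_curveOf (L.stitches.finite_toSet.subset fun _ hr => hr.1))
    (fun q hq => by
      obtain ⟨r, hr, hqr⟩ := mem_curveOf.1 hq
      obtain ⟨b, hb⟩ := exists_isEnd r
      by_cases hPb : P b
      · exact .inl (mem_curveOf.2 ⟨r, ⟨hr, fun a ha => hP r hr b a hb ha hPb⟩, hqr⟩)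
      · exact .inr (mem_curveOf.2 ⟨r, ⟨hr, fun a ha hPa => hPb (hP r hr a b ha hb hPa)⟩, hqr⟩))
    ⟨toPlane c, mem_curveOf.2 ⟨s, hs, toPlane_mem_seg hc⟩,
      mem_curveOf.2 ⟨s, ⟨hs, fun a ha => hP s hs c a hc ha h⟩, toPlane_mem_seg hc⟩⟩
    ⟨toPlane d, mem_curveOf.2 ⟨t, ht, toPlane_mem_seg hd⟩,
      mem_curveOf.2 ⟨t, ⟨ht, fun a ha hPa => hd' (hP t ht a d ha hd hPa)⟩, toPlane_mem_seg hd⟩⟩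
  obtain ⟨q, -, hqS, hqT⟩ := hpre
  obtain ⟨r, hr, hqr⟩ := mem_curveOf.1 hqS
  obtain ⟨r', hr', hqr'⟩ := mem_curveOf.1 hqT
  have hne : r ≠ r' := by
    rintro rfl
    obtain ⟨b, hb⟩ := exists_isEnd r
    exact hr'.2 b hb (hr.2 b hb)
  obtain ⟨b, hb, hb', -⟩ := exists_isEnd_of_mem_seg hne hqr hqr'
  exact hr'.2 b hb' (hr.2 b hb)

lemma isEnd_horiz_iff {i j a b : ℤ} :
    IsEnd (i, j) (.horiz a b) ↔ b = j ∧ (a = i ∨ a = i - 1) := by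
  simp only [IsEnd, Prod.mk.injEq]
  omega

lemma isEnd_vert_iff {i j a b : ℤ} :
    IsEnd (i, j) (.vert a b) ↔ a = i ∧ (b = j ∨ b = j - 1) := by
  simp only [IsEnd, Prod.mk.injEq]
  omega

lemma exists_isEnd_horiz (L : HLoop ε η) {i j : ℤ}
    (h : Stitch.horiz i j ∈ L.stitches ∨ Stitch.horiz (i - 1) j ∈ L.stitches) :
    ∃ s ∈ L.stitches, IsEnd (i, j) s ∧ ∃ a b, s = .horiz a b := by
  rcases h with h | h
  · exact ⟨_, h, by simp [IsEnd], _, _, rfl⟩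
  · exact ⟨_, h, by simp [IsEnd], _, _, rfl⟩

lemma exists_isEnd_vert (L : HLoop ε η) {i j : ℤ}
    (h : Stitch.vert i j ∈ L.stitches ∨ Stitch.vert i (j - 1) ∈ L.stitches) :
    ∃ s ∈ L.stitches, IsEnd (i, j) s ∧ ∃ a b, s = .vert a b := by
  rcases h with h | h
  · exact ⟨_, h, by simp [IsEnd], _, _, rfl⟩
  · exact ⟨_, h, by simp [IsEnd], _, _, rfl⟩

lemma loopData (L : HLoop ε η) : LoopData ε η (fun i j => Stitch.horiz i j ∈ L.stitches)
    (fun i j => Stitch.vert i j ∈ L.stitches) where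
  horiz h := L.inPattern _ h
  vert h := L.inPattern _ h
  turn i j := by
    constructor <;> intro h
    · obtain ⟨s, hs, hc, a, b, rfl⟩ := exists_isEnd_horiz L h
      obtain ⟨t, ht, hts, hct⟩ := exists_other_stitch L hs hc
      rcases t with ⟨a', b'⟩ | ⟨a', b'⟩
      · obtain ⟨rfl, rfl | rfl⟩ := isEnd_vert_iff.1 hct
        exacts [.inl ht, .inr ht]
      · have h1 : (a : ZMod 2) = η b := L.inPattern _ hs
        have h2 : (a' : ZMod 2) = η b' := L.inPattern _ ht
        obtain ⟨rfl, rfl | rfl⟩ := isEnd_horiz_iff.1 hc <;>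
          obtain ⟨rfl, rfl | rfl⟩ := isEnd_horiz_iff.1 hct
        exacts [(hts rfl).elim, (not_cast_sub_one_eq h1 h2).elim,
          (not_cast_sub_one_eq h2 h1).elim, (hts rfl).elim]
    · obtain ⟨s, hs, hc, a, b, rfl⟩ := exists_isEnd_vert L h
      obtain ⟨t, ht, hts, hct⟩ := exists_other_stitch L hs hc
      rcases t with ⟨a', b'⟩ | ⟨a', b'⟩
      · have h1 : (b : ZMod 2) = ε a := L.inPattern _ hs
        have h2 : (b' : ZMod 2) = ε a' := L.inPattern _ ht
        obtain ⟨rfl, rfl | rfl⟩ := isEnd_vert_iff.1 hc <;>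
          obtain ⟨rfl, rfl | rfl⟩ := isEnd_vert_iff.1 hct
        exacts [(hts rfl).elim, (not_cast_sub_one_eq h1 h2).elim,
          (not_cast_sub_one_eq h2 h1).elim, (hts rfl).elim]
      · obtain ⟨rfl, rfl | rfl⟩ := isEnd_horiz_iff.1 hct
        exacts [.inl ht, .inr ht]
  conn P hP hQ i j i' j' h h' hPij := by
    obtain ⟨s, hs, hc, -⟩ := exists_isEnd_horiz L h
    obtain ⟨t, ht, hd, -⟩ := exists_isEnd_horiz L h'
    refine forall_end_of_exists L (fun c => P c.1 c.2) ?_ hs ht hc hd hPij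
    rintro (⟨a, b⟩ | ⟨a, b⟩) hr c d (rfl | rfl) (rfl | rfl) <;> dsimp only
    exacts [id, (hQ a b hr).1, (hQ a b hr).2, id, id, (hP a b hr).1, (hP a b hr).2, id]
  finite_horiz := L.stitches.finite_toSet.preimage (f := fun p : ℤ × ℤ => Stitch.horiz p.1 p.2)
    (Function.Injective.injOn fun p q h => by simpa [Prod.ext_iff] using h)
  finite_vert := L.stitches.finite_toSet.preimage (f := fun p : ℤ × ℤ => Stitch.vert p.1 p.2)
    (Function.Injective.injOn fun p q h => by simpa [Prod.ext_iff] using h)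

end Hitomezashi

/-- A hitomezashi loop `L` has a north-extremal horizontal stitch at
longitude `i + 1/2` if and only if it has a south-extremal horizontal stitch at longitude
`i + 1/2`; similarly, it has an east-extremal vertical stitch at latitude `j + 1/2` if and
only if it has a west-extremal vertical stitch at latitude `j + 1/2`. -/
theorem hitomezashi_extremal_match (ε η : ℤ → ZMod 2) (L : HLoop ε η) :
    (∀ i : ℤ,
      (∃ j, Stitch.horiz i j ∈ L.stitches ∧
        ∀ i' j' : ℤ, Stitch.horiz i' j' ∈ L.stitches → j' ≤ j) ↔
      (∃ j, Stitch.horiz i j ∈ L.stitches ∧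
        ∀ i' j' : ℤ, Stitch.horiz i' j' ∈ L.stitches → j ≤ j')) ∧
    (∀ j : ℤ,
      (∃ i, Stitch.vert i j ∈ L.stitches ∧
        ∀ i' j' : ℤ, Stitch.vert i' j' ∈ L.stitches → i' ≤ i) ↔
      (∃ i, Stitch.vert i j ∈ L.stitches ∧
        ∀ i' j' : ℤ, Stitch.vert i' j' ∈ L.stitches → i ≤ i')) := by
  refine ⟨(loopData L).north_iff_south, fun j => ?_⟩
  have := (loopData L).swap.north_iff_south j
  rw [exists_congr fun i => and_congr_right' forall_comm, this,
    exists_congr fun i => and_congr_right' forall_comm]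
end
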